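/- arXiv:0808.0510 — 2 statements merged into one kernel-verified Lean document; each statement's English description precedes it below -/
import Mathlib

section
/- Lemma (zero-sum connection set): let Ω be a finite set of nonempty vectors in ℤ₂ⁿ with d = |Ω| ≥ 1 and Σ_{w ∈ Ω} w = 0 (XOR of all elements of Ω is zero). Then for every v ∈ ℤ₂ⁿ the eigenvalue λ_v = Σ_{w ∈ Ω} (-1)^{w·v} satisfies λ_v = d - 4k_v for some natural number k_v with 0 ≤ k_v ≤ ⌊d/2⌋; equivalently λ_v ≡ d (mod 4) and -d ≤ λ_v ≤ d. -/
open Matrix Complex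

noncomputable section

/-- The group `ℤ₂ⁿ`, realized as functions `Fin n → ZMod 2` with pointwise addition (XOR). -/
abbrev G (n : ℕ) := Fin n → ZMod 2

/-- The natural-number scalar product `w·v = Σᵢ (w i).val * (v i).val`. -/
def dot {n : ℕ} (w v : G n) : ℕ := ∑ i, (w i).val * (v i).val

/-- Adjacency matrix of the cubelike graph `X(ℤ₂ⁿ, Ω)`. -/
def adjMatrix {n : ℕ} (Ω : Finset (G n)) : Matrix (G n) (G n) ℂ :=
  Matrix.of fun x y => if x + y ∈ Ω then 1 else 0

/-- Eigenvalue `λ_v = Σ_{w ∈ Ω} (-1)^(w·v)` of the cubelike graph `X(ℤ₂ⁿ, Ω)`. -/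
def eigval {n : ℕ} (Ω : Finset (G n)) (v : G n) : ℤ := ∑ w ∈ Ω, (-1 : ℤ) ^ dot w v

theorem natCast_dot {n : ℕ} (w v : G n) : (dot w v : ZMod 2) = w ⬝ᵥ v := by
  simp [dot, dotProduct]

theorem eigval_eq_card_sub_two_mul {n : ℕ} (Ω : Finset (G n)) (v : G n) :
    eigval Ω v = (Ω.card : ℤ) - 2 * ((Ω.filter fun w => Odd (dot w v)).card : ℤ) := by
  have sign_eq (w : G n) :
      (-1 : ℤ) ^ dot w v = 1 - 2 * (if Odd (dot w v) then 1 else 0) := by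
    split_ifs with h
    · simp [h.neg_one_pow]
    · simp [(Nat.not_odd_iff_even.mp h).neg_one_pow]
  simp only [eigval, sign_eq, Finset.sum_sub_distrib, ← Finset.mul_sum, Finset.sum_boole]
  simp

theorem even_card_filter_odd_dot {n : ℕ} (Ω : Finset (G n)) (hsum : (∑ w ∈ Ω, w) = 0) (v : G n) :
    Even (Ω.filter fun w => Odd (dot w v)).card := by
  rw [← Finset.even_sum_iff_even_card_odd, ← ZMod.natCast_eq_zero_iff_even]
  simp only [Nat.cast_sum, natCast_dot]
  rw [← sum_dotProduct, hsum, zero_dotProduct]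

/-- If the XOR of all elements of Ω is zero, then every eigenvalue has the form d - 4k
with 0 ≤ k ≤ ⌊d/2⌋. -/
theorem eigval_of_sum_zero {n : ℕ} (Ω : Finset (G n)) (hΩ : ∀ w ∈ Ω, w ≠ 0)
    (hd : 1 ≤ Ω.card) (hsum : (∑ w ∈ Ω, w) = 0) (v : G n) :
    ∃ k : ℕ, k ≤ Ω.card / 2 ∧ eigval Ω v = (Ω.card : ℤ) - 4 * k := by
  obtain ⟨k, hk⟩ := even_card_filter_odd_dot Ω hsum v
  have hle := Finset.card_filter_le Ω fun w => Odd (dot w v)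
  have heq := eigval_eq_card_sub_two_mul Ω v
  exact ⟨k, by omega, by omega⟩

end
end

section
/- Lemma (nonzero sum, sum in the set): let Ω be a finite set of vectors in ℤ₂ⁿ with d = |Ω|, and suppose u := Σ_{w ∈ Ω} w ≠ 0 and u ∈ Ω. Then for every v ∈ ℤ₂ⁿ the eigenvalue λ_v = Σ_{w ∈ Ω} (-1)^{w·v} satisfies: λ_v = d - 4k_v if u·v is even, and λ_v = d - 4k_v - 2 if u·v is odd, for some natural number k_v with 0 ≤ k_v ≤ ⌊(d-1)/2⌋. Equivalently, λ_v ≡ d (mod 4) when u·v is even and λ_v ≡ d - 2 (mod 4) when u·v is odd. -/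
open Matrix Complex

noncomputable section

theorem eigval_eq_card_sub {n : ℕ} (Ω : Finset (G n)) (v : G n) :
    eigval Ω v = (Ω.card : ℤ) - 2 * (Ω.filter fun w => Odd (dot w v)).card := by
  have h : ∀ w : G n, (-1 : ℤ) ^ dot w v = 1 - 2 * if Odd (dot w v) then 1 else 0 := by
    intro w
    split_ifs with hw
    · simp [hw.neg_one_pow]
    · simp [(Nat.not_odd_iff_even.mp hw).neg_one_pow]
  simp only [eigval, h, Finset.sum_sub_distrib, ← Finset.mul_sum, Finset.sum_boole,
    Finset.sum_const, nsmul_eq_mul, mul_one]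

theorem even_dot_sum_iff {n : ℕ} (Ω : Finset (G n)) (v : G n) :
    Even (dot (∑ w ∈ Ω, w) v) ↔ Even (Ω.filter fun w => Odd (dot w v)).card := by
  have h : ∀ w : G n, w ⬝ᵥ v = if Odd (dot w v) then 1 else 0 := by
    intro w
    rw [← natCast_dot]
    split_ifs with hw
    · exact ZMod.natCast_eq_one_iff_odd.mpr hw
    · exact ZMod.natCast_eq_zero_iff_even.mpr (Nat.not_odd_iff_even.mp hw)
  rw [← ZMod.natCast_eq_zero_iff_even, ← ZMod.natCast_eq_zero_iff_even, natCast_dot,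
    sum_dotProduct, Finset.sum_congr rfl fun w _ => h w, Finset.sum_boole]

/-- If u = ⊕_{w ∈ Ω} w is nonzero and u ∈ Ω, then λ_v = d - 4k when u·v is even and
λ_v = d - 4k - 2 when u·v is odd, with 0 ≤ k ≤ ⌊(d-1)/2⌋. -/
theorem eigval_of_sum_mem {n : ℕ} (Ω : Finset (G n))
    (hu : (∑ w ∈ Ω, w) ≠ 0) (hmem : (∑ w ∈ Ω, w) ∈ Ω) (v : G n) :
    ∃ k : ℕ, k ≤ (Ω.card - 1) / 2 ∧
      eigval Ω v =
        if Even (dot (∑ w ∈ Ω, w) v) then (Ω.card : ℤ) - 4 * k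
        else (Ω.card : ℤ) - 4 * k - 2 := by
  have hle := Finset.card_filter_le Ω fun w => Odd (dot w v)
  rw [eigval_eq_card_sub]
  split_ifs with he
  · have hlt : (Ω.filter fun w => Odd (dot w v)).card < Ω.card :=
      Finset.card_lt_card <| Finset.filter_ssubset.mpr
        ⟨_, hmem, Nat.not_odd_iff_even.mpr he⟩
    obtain ⟨k, hk⟩ := (even_dot_sum_iff Ω v).mp he
    exact ⟨k, by omega, by omega⟩
  · obtain ⟨k, hk⟩ := Nat.not_even_iff_odd.mp (mt (even_dot_sum_iff Ω v).mpr he)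
    exact ⟨k, by omega, by omega⟩

end
end
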